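/- Let p be a fixed pivot vertex, let u₁, …, u_l be vertices distinct from p, and for each i let L_i be the latest minimum (u_i,p)-cut side. If the sets L_1, …, L_l pairwise intersect (L_i ∩ L_j ≠ ∅ for all i, j), then they are totally ordered by inclusion: there is a permutation σ with L_{σ(1)} ⊆ L_{σ(2)} ⊆ ⋯ ⊆ L_{σ(l)}. -/

import Mathlib

open Finset

variable {V : Type*}

/-- The cut value of a set `S`: total weight of pairs crossing `(S, Sᶜ)`. -/
def cutValue [Fintype V] [DecidableEq V] (w : V → V → ℝ) (S : Finset V) : ℝ :=
  ∑ x ∈ S, ∑ y ∈ Sᶜ, w x y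

/-- `S` is an `(s,t)`-cut side if `s ∈ S` and `t ∉ S`. -/
def IsCutSide [Fintype V] [DecidableEq V] (s t : V) (S : Finset V) : Prop :=
  s ∈ S ∧ t ∉ S

/-- `S` is a minimum `(s,t)`-cut side. -/
def IsMinCutSide [Fintype V] [DecidableEq V] (w : V → V → ℝ) (s t : V) (S : Finset V) : Prop :=
  IsCutSide s t S ∧ ∀ S' : Finset V, IsCutSide s t S' → cutValue w S ≤ cutValue w S'

/-- `S` is a latest minimum `(s,t)`-cut side: a minimum cut side of minimum cardinality
among all minimum cut sides. -/
def IsLatestMinCutSide [Fintype V] [DecidableEq V] (w : V → V → ℝ) (s t : V) (S : Finset V) : Prop :=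
  IsMinCutSide w s t S ∧ ∀ S' : Finset V, IsMinCutSide w s t S' → S.card ≤ S'.card

theorem cutValue_eq_sum_ite [Fintype V] [DecidableEq V] (w : V → V → ℝ) (S : Finset V) :
    cutValue w S = ∑ x, ∑ y, if x ∈ S ∧ y ∉ S then w x y else 0 := by
  simp [cutValue, ite_and, Finset.sum_ite, ← Finset.compl_filter]

theorem cutValue_compl [Fintype V] [DecidableEq V] {w : V → V → ℝ}
    (hsymm : ∀ x y, w x y = w y x) (S : Finset V) : cutValue w Sᶜ = cutValue w S := by
  unfold cutValue
  rw [compl_compl, Finset.sum_comm]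
  simp only [fun x y => hsymm y x]

/-- The cut function is submodular. -/
theorem cutValue_inter_add_cutValue_union_le [Fintype V] [DecidableEq V] {w : V → V → ℝ}
    (hnonneg : ∀ x y, 0 ≤ w x y) (A B : Finset V) :
    cutValue w (A ∩ B) + cutValue w (A ∪ B) ≤ cutValue w A + cutValue w B := by
  simp only [cutValue_eq_sum_ite, ← Finset.sum_add_distrib]
  refine Finset.sum_le_sum fun x _ => Finset.sum_le_sum fun y _ => ?_
  have := hnonneg x y
  by_cases hxA : x ∈ A <;> by_cases hxB : x ∈ B <;> by_cases hyA : y ∈ A <;>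
    by_cases hyB : y ∈ B <;> simp [*]

/-- The cut function of an undirected graph is posimodular. -/
theorem cutValue_sdiff_add_cutValue_sdiff_le [Fintype V] [DecidableEq V] {w : V → V → ℝ}
    (hsymm : ∀ x y, w x y = w y x) (hnonneg : ∀ x y, 0 ≤ w x y) (A B : Finset V) :
    cutValue w (A \ B) + cutValue w (B \ A) ≤ cutValue w A + cutValue w B := by
  have h := cutValue_inter_add_cutValue_union_le hnonneg A Bᶜ
  have hAB : A ∪ Bᶜ = (B \ A)ᶜ := by
    ext x
    simp
    tauto
  rwa [hAB, cutValue_compl hsymm, cutValue_compl hsymm, ← Finset.sdiff_eq_inter_compl] at h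

/-- A cut side contained in a latest minimum cut side, of no larger value, is equal to it. -/
theorem IsLatestMinCutSide.eq_of_subset [Fintype V] [DecidableEq V] {w : V → V → ℝ} {s t : V}
    {A S : Finset V} (hA : IsLatestMinCutSide w s t A) (hsub : S ⊆ A) (hs : s ∈ S)
    (hle : cutValue w S ≤ cutValue w A) : S = A :=
  Finset.eq_of_subset_of_card_le hsub <|
    hA.2 S ⟨⟨hs, fun h => hA.1.1.2 (hsub h)⟩, fun S' hS' => hle.trans (hA.1.2 S' hS')⟩

theorem IsLatestMinCutSide.subset_of_mem [Fintype V] [DecidableEq V] {w : V → V → ℝ}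
    (hnonneg : ∀ x y, 0 ≤ w x y) {a b p : V} {A B : Finset V}
    (hA : IsLatestMinCutSide w a p A) (hB : IsLatestMinCutSide w b p B) (ha : a ∈ B) :
    A ⊆ B := by
  have hU := hB.1.2 (A ∪ B)
    ⟨Finset.mem_union_right _ hB.1.1.1, by simp [hA.1.1.2, hB.1.1.2]⟩
  have hsub := cutValue_inter_add_cutValue_union_le hnonneg A B
  exact Finset.inter_eq_left.1 <| hA.eq_of_subset Finset.inter_subset_left
    (Finset.mem_inter.2 ⟨hA.1.1.1, ha⟩) (by linarith)

/-- Two intersecting latest minimum cut sides with the same pivot are nested. -/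
theorem IsLatestMinCutSide.subset_or_subset [Fintype V] [DecidableEq V] {w : V → V → ℝ}
    (hsymm : ∀ x y, w x y = w y x) (hnonneg : ∀ x y, 0 ≤ w x y) {a b p : V} {A B : Finset V}
    (hA : IsLatestMinCutSide w a p A) (hB : IsLatestMinCutSide w b p B)
    (hAB : (A ∩ B).Nonempty) : A ⊆ B ∨ B ⊆ A := by
  by_cases ha : a ∈ B
  · exact Or.inl (hA.subset_of_mem hnonneg hB ha)
  by_cases hb : b ∈ A
  · exact Or.inr (hB.subset_of_mem hnonneg hA hb)
  have hD := hB.1.2 (B \ A)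
    ⟨Finset.mem_sdiff.2 ⟨hB.1.1.1, hb⟩, fun h => hB.1.1.2 (Finset.mem_sdiff.1 h).1⟩
  have hpos := cutValue_sdiff_add_cutValue_sdiff_le hsymm hnonneg A B
  have heq := hA.eq_of_subset Finset.sdiff_subset
    (Finset.mem_sdiff.2 ⟨hA.1.1.1, ha⟩) (by linarith)
  exact absurd (Finset.sdiff_eq_self_iff_disjoint.1 heq)
    (Finset.not_disjoint_iff_nonempty_inter.2 hAB)

theorem latest_min_cuts_total_order [Fintype V] [DecidableEq V] [Nonempty V] (w : V → V → ℝ)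
    (hsymm : ∀ x y, w x y = w y x) (hnonneg : ∀ x y, 0 ≤ w x y)
    (hzero : ∀ x, w x x = 0)
    (p : V) (l : ℕ) (u : Fin l → V) (hu : ∀ i, u i ≠ p)
    (L : Fin l → Finset V)
    (hL : ∀ i, IsLatestMinCutSide w (u i) p (L i))
    (hinter : ∀ i j, (L i ∩ L j).Nonempty) :
    ∃ σ : Equiv.Perm (Fin l), ∀ i j : Fin l, i ≤ j → L (σ i) ⊆ L (σ j) := by
  refine ⟨Tuple.sort fun i => (L i).card, fun i j hij => ?_⟩
  have hcard := Tuple.monotone_sort (fun i => (L i).card) hij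
  rcases (hL _).subset_or_subset hsymm hnonneg (hL _) (hinter _ _) with h | h
  · exact h
  · exact (Finset.eq_of_subset_of_card_le h hcard).superset
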